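/- Let A be an AB3 abelian category. Then the following are equivalent: (i) A is AB4; (ii) for every nonempty set I and family {A_i} of objects of A, the coproduct of the A_i computed in A coincides with (i.e. is sent by the canonical functor to) the coproduct of the A_i computed in the derived category D(A); (iii) the natural map Ext¹_A(⨁_{i∈I}A_i, B) → ∏ Ext¹_A(A_i, B) is an isomorphism for all such families and objects B. -/

import Mathlib

open CategoryTheory CategoryTheory.Limits CategoryTheory.Abelian

universe w v u

/-- The coproduct of a family of short complexes. -/
noncomputable def sigmaShortComplex {A : Type u} [Category.{v} A] [Abelian A]
    {I : Type w} (S : I → ShortComplex A)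
    [HasCoproduct (fun i => (S i).X₁)] [HasCoproduct (fun i => (S i).X₂)]
    [HasCoproduct (fun i => (S i).X₃)] : ShortComplex A :=
  ShortComplex.mk (Limits.Sigma.map fun i => (S i).f) (Limits.Sigma.map fun i => (S i).g)
    (by rw [Limits.Sigma.map_comp_map]; ext i; simp [(S i).zero])

section

variable {A : Type u} [Category.{v} A] [Abelian A]

lemma sigmaShortComplex_shortExact_of_mono {I : Type w} (S : I → ShortComplex A)
    [HasCoproduct (fun i => (S i).X₁)] [HasCoproduct (fun i => (S i).X₂)]
    [HasCoproduct (fun i => (S i).X₃)] (hS : ∀ i, (S i).ShortExact)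
    [Mono (Limits.Sigma.map fun i => (S i).f)] : (sigmaShortComplex S).ShortExact := by
  have hg : Epi (sigmaShortComplex S).g := by
    have := fun i => (hS i).epi_g
    dsimp [sigmaShortComplex]
    constructor
    intro Z a b h
    ext i
    have h' := Sigma.ι _ i ≫= h
    simpa [cancel_epi] using h'
  refine ShortComplex.ShortExact.mk' ?_ (by assumption) hg
  refine ShortComplex.exact_of_g_is_cokernel _ (CokernelCofork.IsColimit.ofπ' _ _ fun k hk => ?_)
  have hk' (i : I) : (S i).f ≫ Sigma.ι (fun i => (S i).X₂) i ≫ k = 0 := by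
    have h : Sigma.ι (fun i => (S i).X₁) i ≫ Limits.Sigma.map (fun i => (S i).f) ≫ k = 0 :=
      (Sigma.ι _ i ≫= hk).trans comp_zero
    exact (Sigma.ι_map_assoc _ i _).symm.trans h
  refine ⟨Sigma.desc fun i => (hS i).gIsCokernel.desc (CokernelCofork.ofπ _ (hk' i)), ?_⟩
  apply Sigma.hom_ext
  intro i
  change Sigma.ι _ i ≫ Limits.Sigma.map (fun i => (S i).g) ≫ Sigma.desc _ = _
  rw [Sigma.ι_map_assoc, Sigma.ι_desc]
  exact (hS i).gIsCokernel.fac (CokernelCofork.ofπ _ (hk' i)) .one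

lemma exists_mono_ext_comp_eq_zero [HasExt.{w} A] {X Y : A} (η : Ext X Y 1) :
    ∃ (J : A) (m : Y ⟶ J), Mono m ∧ η.comp (Ext.mk₀ m) (add_zero 1) = 0 := by
  let := HasDerivedCategory.standard A
  let e := (DerivedCategory.singleFunctors A).shiftIso 1 (-1) 0 (by lia)
  let η' : DerivedCategory.Q.obj ((HomologicalComplex.single A (.up ℤ) 0).obj X) ⟶
      DerivedCategory.Q.obj ((HomologicalComplex.single A (.up ℤ) (-1)).obj Y) :=
    η.hom ≫ e.hom.app Y
  have : CochainComplex.IsStrictlyGE ((HomologicalComplex.single A (.up ℤ) (-1)).obj Y) (-1) :=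
    inferInstanceAs (CochainComplex.IsStrictlyGE
      ((CochainComplex.singleFunctor A (-1)).obj Y) (-1))
  obtain ⟨K, _, g, s, _, fac⟩ := DerivedCategory.left_fac_of_isStrictlyGE η' (-1)
  let p : K ⟶ (HomologicalComplex.single A (.up ℤ) (-1)).obj (K.X (-1)) :=
    HomologicalComplex.mkHomToSingle (𝟙 _) (fun i hi =>
      (K.isZero_of_isStrictlyGE (-1) i (by simp at hi; lia)).eq_of_src _ _)
  let m : Y ⟶ K.X (-1) := (HomologicalComplex.singleObjXSelf _ _ _).inv ≫ s.f (-1)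
  have hm : s ≫ p = (HomologicalComplex.single A (.up ℤ) (-1)).map m := by
    ext
    simp [m, p, HomologicalComplex.single_map_f_self]
  have hg : g ≫ p = 0 := by
    apply HomologicalComplex.to_single_hom_ext
    exact (HomologicalComplex.isZero_single_obj_X _ _ _ _ (by lia)).eq_of_src _ _
  refine ⟨K.X (-1), m, ?_, ?_⟩
  · refine Preadditive.mono_of_cancel_zero _ fun {Z} a ha => ?_
    have h : (HomologicalComplex.single A (.up ℤ) (-1)).map a ≫ s = 0 := by
      apply HomologicalComplex.from_single_hom_ext
      simpa [m, HomologicalComplex.single_map_f_self] using ha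
    apply (DerivedCategory.singleFunctor A (-1)).map_injective
    rw [Functor.map_zero]
    change DerivedCategory.Q.map ((HomologicalComplex.single A (.up ℤ) (-1)).map a) = 0
    rw [← cancel_mono (DerivedCategory.Q.map s), ← Functor.map_comp, h, Functor.map_zero]
    exact zero_comp.symm
  · ext
    rw [← Ext.hom_comp_singleFunctor_map_shift, Ext.zero_hom]
    have nat := e.hom.naturality m
    rw [← cancel_mono (e.hom.app _), Category.assoc]
    erw [nat]
    rw [← Category.assoc]
    change η' ≫ DerivedCategory.Q.map ((HomologicalComplex.single A (.up ℤ) (-1)).map m) = _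
    rw [fac, ← hm, Functor.map_comp, Category.assoc, IsIso.inv_hom_id_assoc, ← Functor.map_comp,
      hg, Functor.map_zero]
    exact zero_comp.symm

lemma mono_sigmaMap_of_surjective_ext [HasExt.{w} A] {I : Type*} (S : I → ShortComplex A)
    [HasCoproduct (fun i => (S i).X₁)] [HasCoproduct (fun i => (S i).X₂)]
    [HasCoproduct (fun i => (S i).X₃)] (hS : ∀ i, (S i).ShortExact)
    (h : Function.Surjective
      (fun (η : Ext (∐ fun i => (S i).X₃) (∐ fun i => (S i).X₁) 1) (i : I) =>
        (Ext.mk₀ (Sigma.ι (fun i => (S i).X₃) i)).comp η (zero_add 1))) :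
    Mono (Limits.Sigma.map fun i => (S i).f) := by
  obtain ⟨η, hη⟩ := h fun i =>
    (hS i).extClass.comp (Ext.mk₀ (Sigma.ι (fun i => (S i).X₁) i)) (add_zero 1)
  obtain ⟨J, m, _, hm⟩ := exists_mono_ext_comp_eq_zero η
  have (i : I) : ∃ y : (S i).X₂ ⟶ J, (S i).f ≫ y = Sigma.ι (fun i => (S i).X₁) i ≫ m := by
    obtain ⟨x, hx⟩ := Ext.contravariant_sequence_exact₁ (hS i) J
      (Ext.mk₀ (Sigma.ι (fun i => (S i).X₁) i ≫ m)) (add_zero 1) (by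
        rw [← Ext.mk₀_comp_mk₀, ← Ext.comp_assoc_of_third_deg_zero, ← congr_fun hη i,
          Ext.comp_assoc_of_third_deg_zero, hm, Ext.comp_zero])
    obtain ⟨y, rfl⟩ := (Ext.mk₀_bijective _ _).2 x
    exact ⟨y, (Ext.mk₀_bijective _ _).1 (by rw [← hx, Ext.mk₀_comp_mk₀])⟩
  choose y hy using this
  have fac : Limits.Sigma.map (fun i => (S i).f) ≫ Sigma.desc y = m := by
    ext i
    simp [hy]
  exact mono_of_mono_fac fac

end

section

variable {A : Type u} [Category.{v} A] {I : Type*}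

lemma isoOfNatIso_natIsoFunctor_hom_comp_colimMap [HasColimitsOfShape (Discrete I) A]
    {F G : Discrete I ⥤ A} (α : F ⟶ G) :
    (HasColimit.isoOfNatIso Discrete.natIsoFunctor.symm).hom ≫ colimMap α =
      Limits.Sigma.map (fun i => α.app ⟨i⟩) ≫
        (HasColimit.isoOfNatIso Discrete.natIsoFunctor.symm).hom := by
  refine colimit.hom_ext fun ⟨i⟩ => ?_
  simp [Limits.Sigma.map]

end

section

variable {A : Type u} [Category.{v} A] [Abelian A] {I : Type*}

namespace HomologicalComplex

variable {ι : Type*} {c : ComplexShape ι}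

/-- A family of complexes in `A`, as a complex in the category of families of objects of `A`. -/
def ofFamily (K : I → HomologicalComplex A c) : HomologicalComplex (Discrete I ⥤ A) c where
  X n := Discrete.functor fun i => (K i).X n
  d n m := Discrete.natTrans fun i => (K i.as).d n m
  shape n m h := by
    ext i
    exact (K i.as).shape n m h

/-- The morphism induced on complexes of families by a family of morphisms of complexes. -/
def ofFamilyMap {K L : I → HomologicalComplex A c} (φ : ∀ i, K i ⟶ L i) :
    ofFamily K ⟶ ofFamily L where
  f n := Discrete.natTrans fun i => (φ i.as).f n
  comm' n m _ := by
    ext i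
    exact (φ i.as).comm n m

lemma quasiIso_ofFamilyMap {K L : I → HomologicalComplex A c} (φ : ∀ i, K i ⟶ L i)
    [hφ : ∀ i, QuasiIso (φ i)] : QuasiIso (ofFamilyMap φ) where
  quasiIsoAt n := by
    rw [quasiIsoAt_iff]
    let γ : ShortComplex.LeftHomologyMapData
      ((shortComplexFunctor (Discrete I ⥤ A) c n).map (ofFamilyMap φ))
      (ShortComplex.leftHomologyData _) (ShortComplex.leftHomologyData _) := default
    rw [γ.quasiIso_iff, NatTrans.isIso_iff_isIso_app]
    rintro ⟨i⟩
    refine (γ.quasiIso_map_iff ((evaluation (Discrete I) A).obj ⟨i⟩)).1 ?_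
    exact (quasiIsoAt_iff (φ i) n).1 inferInstance

end HomologicalComplex

variable [HasColimitsOfShape (Discrete I) A]

instance additive_colim_discrete : (colim : (Discrete I ⥤ A) ⥤ A).Additive where
  map_add {F G f g} := by
    refine colimit.hom_ext fun j => ?_
    simp [Preadditive.comp_add]

lemma preservesHomology_colim_discrete
    (h : ∀ S : I → ShortComplex A, (∀ i, (S i).ShortExact) → (sigmaShortComplex S).ShortExact) :
    (colim : (Discrete I ⥤ A) ⥤ A).PreservesHomology := by
  refine ((Functor.exact_tfae _).out 0 2).1 fun S hS => ?_
  have hS' := h (fun i => S.map ((evaluation (Discrete I) A).obj ⟨i⟩)) fun i => hS.map_of_exact _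
  refine ShortComplex.shortExact_of_iso (ShortComplex.isoMk
    (HasColimit.isoOfNatIso Discrete.natIsoFunctor.symm)
    (HasColimit.isoOfNatIso Discrete.natIsoFunctor.symm)
    (HasColimit.isoOfNatIso Discrete.natIsoFunctor.symm) ?_ ?_) hS'
  · exact isoOfNatIso_natIsoFunctor_hom_comp_colimMap S.f
  · exact isoOfNatIso_natIsoFunctor_hom_comp_colimMap S.g

namespace HomologicalComplex

variable {ι : Type*} {c : ComplexShape ι}

/-- The degreewise coproduct of a family of complexes. -/
@[simps]
noncomputable def sigma (K : I → HomologicalComplex A c) : HomologicalComplex A c where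
  X n := ∐ fun i => (K i).X n
  d n m := Limits.Sigma.map fun i => (K i).d n m
  shape n m h := by
    ext i
    simp [(K i).shape n m h]

/-- The morphism between degreewise coproducts induced by a family of morphisms. -/
@[simps]
noncomputable def sigmaMap {K L : I → HomologicalComplex A c} (φ : ∀ i, K i ⟶ L i) :
    sigma K ⟶ sigma L where
  f n := Limits.Sigma.map fun i => (φ i).f n
  comm' n m _ := by
    change Limits.Sigma.map _ ≫ Limits.Sigma.map (fun i => (L i).d n m) =
      Limits.Sigma.map (fun i => (K i).d n m) ≫ Limits.Sigma.map _
    simp only [Sigma.map_comp_map, Hom.comm]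

lemma quasiIso_sigmaMap [(colim : (Discrete I ⥤ A) ⥤ A).PreservesHomology]
    {K L : I → HomologicalComplex A c} (φ : ∀ i, K i ⟶ L i) [∀ i, QuasiIso (φ i)] :
    QuasiIso (sigmaMap φ) :=
  have := quasiIso_ofFamilyMap φ
  inferInstanceAs (QuasiIso ((colim.mapHomologicalComplex c).map (ofFamilyMap φ)))

/-- The inclusions of a family of complexes in its degreewise coproduct. -/
@[simps]
noncomputable def sigmaι (K : I → HomologicalComplex A c) (i : I) : K i ⟶ sigma K where
  f n := Sigma.ι (fun i => (K i).X n) i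
  comm' n m _ := Sigma.ι_map (fun i => (K i).d n m) i

/-- The morphism from a degreewise coproduct induced by a family of morphisms. -/
@[simps]
noncomputable def sigmaDesc {K : I → HomologicalComplex A c} {L : HomologicalComplex A c}
    (φ : ∀ i, K i ⟶ L) : sigma K ⟶ L where
  f n := Sigma.desc fun i => (φ i).f n
  comm' n m _ := by
    apply Sigma.hom_ext
    intro i
    change Sigma.ι (fun i => (K i).X n) i ≫ Sigma.desc _ ≫ L.d n m =
      Sigma.ι (fun i => (K i).X n) i ≫ Limits.Sigma.map (fun i => (K i).d n m) ≫ Sigma.desc _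
    rw [Sigma.ι_desc_assoc, Sigma.ι_map_assoc, Sigma.ι_desc, Hom.comm]

@[simp]
lemma sigmaι_desc {K : I → HomologicalComplex A c} {L : HomologicalComplex A c}
    (φ : ∀ i, K i ⟶ L) (i : I) : sigmaι K i ≫ sigmaDesc φ = φ i := by
  ext n
  exact Sigma.ι_desc _ i

lemma sigmaι_map {K L : I → HomologicalComplex A c} (φ : ∀ i, K i ⟶ L i) (i : I) :
    sigmaι K i ≫ sigmaMap φ = φ i ≫ sigmaι L i := by
  ext n
  exact Sigma.ι_map (fun i => (φ i).f n) i

lemma sigma_hom_ext {K : I → HomologicalComplex A c} {L : HomologicalComplex A c}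
    {f g : sigma K ⟶ L} (h : ∀ i, sigmaι K i ≫ f = sigmaι K i ≫ g) : f = g := by
  ext n
  apply Sigma.hom_ext
  intro i
  exact congr_hom (h i) n

/-- The degreewise coproduct is a coproduct in the category of complexes. -/
noncomputable def isColimitSigma (K : I → HomologicalComplex A c) :
    IsColimit (Cofan.mk (sigma K) (sigmaι K)) :=
  Cofan.IsColimit.mk _ (fun s => sigmaDesc s.inj) (fun s i => sigmaι_desc _ i)
    (fun s m hm => sigma_hom_ext fun i => by simpa using hm i)

lemma sigmaι_map_desc_add_desc_comp {X Y : I → A} {Z W : A} (d : ∀ i, X i ⟶ Y i)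
    (h : ∀ i, Y i ⟶ Z) (h' : ∀ i, X i ⟶ W) (e : W ⟶ Z) (i : I) :
    Sigma.ι X i ≫ (Limits.Sigma.map d ≫ Sigma.desc h + Sigma.desc h' ≫ e + 0) =
      d i ≫ h i + h' i ≫ e + 0 := by
  simp [Preadditive.comp_add]

/-- A morphism from a degreewise coproduct is null-homotopic if its components are. -/
noncomputable def sigmaHomotopyZero {K : I → HomologicalComplex A c} {L : HomologicalComplex A c}
    (f : sigma K ⟶ L) (h : ∀ i, Homotopy (sigmaι K i ≫ f) 0) : Homotopy f 0 where
  hom n m := Sigma.desc fun i => (h i).hom n m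
  zero n m hnm := by
    apply Sigma.hom_ext
    intro i
    change Sigma.ι (fun i => (K i).X n) i ≫ Sigma.desc _ = Sigma.ι (fun i => (K i).X n) i ≫ 0
    rw [Sigma.ι_desc, (h i).zero n m hnm, comp_zero]
  comm n := by
    apply Sigma.hom_ext
    intro i
    refine ((h i).comm n).trans ?_
    exact (sigmaι_map_desc_add_desc_comp (fun i => (K i).d n (c.next n))
      (fun i => (h i).hom (c.next n) n) (fun i => (h i).hom n (c.prev n)) (L.d _ n) i).symm

end HomologicalComplex

namespace DerivedCategory

open HomologicalComplex

variable [HasDerivedCategory.{w} A]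

lemma exists_quasiIso_homotopy_zero {K L : CochainComplex A ℤ} (f : K ⟶ L) (hf : Q.map f = 0) :
    ∃ (K' : CochainComplex A ℤ) (s : K' ⟶ K), QuasiIso s ∧ Nonempty (Homotopy (s ≫ f) 0) := by
  have hf' : Qh.map ((HomotopyCategory.quotient A (.up ℤ)).map f) = Qh.map 0 := by
    rw [← cancel_mono ((quotientCompQhIso A).hom.app L), quotientCompQhIso_hom_naturality, hf]
    simp
  obtain ⟨K', s, hs, fac⟩ :=
    (MorphismProperty.map_eq_iff_precomp Qh (HomotopyCategory.quasiIso A (.up ℤ)) _ _).1 hf'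
  obtain ⟨K', rfl⟩ := HomotopyCategory.quotient_obj_surjective K'
  obtain ⟨s, rfl⟩ := (HomotopyCategory.quotient _ _).map_surjective s
  refine ⟨K', s, ?_, ⟨HomotopyCategory.homotopyOfEq _ _ ?_⟩⟩
  · rwa [HomotopyCategory.quotient_map_mem_quasiIso_iff, mem_quasiIso_iff] at hs
  · simpa using fac

variable [(colim : (Discrete I ⥤ A) ⥤ A).PreservesHomology]

lemma exists_Q_map_sigmaι_comp_eq {K : I → CochainComplex A ℤ} {L : CochainComplex A ℤ}
    (g : ∀ i, Q.obj (K i) ⟶ Q.obj L) :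
    ∃ f : Q.obj (sigma K) ⟶ Q.obj L, ∀ i, Q.map (sigmaι K i) ≫ f = g i := by
  choose K' s hs u hu using fun i => right_fac (g i)
  have := fun i => (isIso_Q_map_iff_quasiIso _ (s i)).1 (hs i)
  have := quasiIso_sigmaMap s
  refine ⟨inv (Q.map (sigmaMap s)) ≫ Q.map (sigmaDesc u), fun i => ?_⟩
  rw [hu, ← cancel_epi (Q.map (s i)), ← Functor.map_comp_assoc, ← sigmaι_map,
    Functor.map_comp_assoc]
  simp [← Functor.map_comp]

lemma Q_map_sigmaι_comp_eq_zero {K : I → CochainComplex A ℤ} {L : CochainComplex A ℤ}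
    (f : Q.obj (sigma K) ⟶ Q.obj L) (hf : ∀ i, Q.map (sigmaι K i) ≫ f = 0) : f = 0 := by
  obtain ⟨L', g, t, _, rfl⟩ := left_fac f
  have (i : I) : Q.map (sigmaι K i ≫ g) = 0 := by
    rw [← cancel_mono (inv (Q.map t)), Functor.map_comp, Category.assoc, hf, zero_comp]
  choose K' s hs h using fun i => exists_quasiIso_homotopy_zero _ (this i)
  have := quasiIso_sigmaMap s
  have h' : Q.map (sigmaMap s ≫ g) = Q.map 0 :=
    Q_map_eq_of_homotopy A (sigmaHomotopyZero (sigmaMap s ≫ g) fun i =>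
      (Homotopy.ofEq (by rw [← Category.assoc, sigmaι_map, Category.assoc])).trans (h i).some)
  rw [Functor.map_comp, Functor.map_zero] at h'
  rw [← cancel_epi (Q.map (sigmaMap s)), ← Category.assoc, h', zero_comp, comp_zero]

lemma preservesColimitsOfShape_discrete_Q :
    PreservesColimitsOfShape (Discrete I) (Q : CochainComplex A ℤ ⥤ DerivedCategory A) := by
  have (K : I → CochainComplex A ℤ) : PreservesColimit (Discrete.functor K)
      (Q : CochainComplex A ℤ ⥤ DerivedCategory A) := by
    refine preservesColimit_of_preserves_colimit_cocone (isColimitSigma K)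
      ((isColimitMapCoconeCofanMkEquiv _ _ _).symm ?_)
    have hex (s : Cofan fun i => Q.obj (K i)) :
        ∃ f : Q.obj (sigma K) ⟶ s.pt, ∀ i, Q.map (sigmaι K i) ≫ f = s.inj i := by
      obtain ⟨f, hf⟩ := exists_Q_map_sigmaι_comp_eq fun i =>
        s.inj i ≫ (Q.objObjPreimageIso s.pt).inv
      exact ⟨f ≫ (Q.objObjPreimageIso s.pt).hom, fun i => by
        rw [← Category.assoc, hf i, Category.assoc, Iso.inv_hom_id, Category.comp_id]⟩
    refine Cofan.IsColimit.mk _ (fun s => (hex s).choose) (fun s => (hex s).choose_spec) ?_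
    intro s m hm
    rw [← sub_eq_zero, ← cancel_mono (Q.objObjPreimageIso s.pt).inv, zero_comp]
    refine Q_map_sigmaι_comp_eq_zero _ fun i => ?_
    have h₁ := hm i
    have h₂ := (hex s).choose_spec i
    dsimp at h₁
    rw [← Category.assoc, Preadditive.comp_sub, h₂]
    erw [h₁]
    simp
  exact preservesColimitsOfShape_of_discrete _

end DerivedCategory

end

section

variable {A : Type u} [Category.{v} A] [Abelian A] {I : Type*} [HasColimitsOfShape (Discrete I) A]

lemma DerivedCategory.preservesColimitsOfShape_discrete_singleFunctor [HasDerivedCategory.{w} A]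
    [(colim : (Discrete I ⥤ A) ⥤ A).PreservesHomology] (n : ℤ) :
    PreservesColimitsOfShape (Discrete I) (singleFunctor A n) :=
  have : PreservesColimitsOfShape (Discrete I) (Q : CochainComplex A ℤ ⥤ DerivedCategory A) :=
    preservesColimitsOfShape_discrete_Q
  preservesColimitsOfShape_of_natIso
    (F := HomologicalComplex.single A (.up ℤ) n ⋙ Q) (singleFunctorIsoCompQ A n).symm

lemma bijective_ext_sigmaι_of_isColimit [HasDerivedCategory.{w} A] [HasExt.{w} A]
    (f : I → A) (B : A)
    (hf : IsColimit (Cofan.mk ((DerivedCategory.singleFunctor A 0).obj (∐ f))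
      (fun i => (DerivedCategory.singleFunctor A 0).map (Sigma.ι f i)))) (n : ℕ) :
    Function.Bijective (fun (η : Ext (∐ f) B n) (i : I) =>
      (Ext.mk₀ (Sigma.ι f i)).comp η (zero_add n)) := by
  refine ⟨fun η η' h => ?_, fun ξ => ?_⟩
  · ext
    refine Cofan.IsColimit.hom_ext hf _ _ fun i => ?_
    change (DerivedCategory.singleFunctor A 0).map _ ≫ _ =
      (DerivedCategory.singleFunctor A 0).map _ ≫ _
    rw [Ext.singleFunctor_map_comp_hom, Ext.singleFunctor_map_comp_hom]
    exact congrArg Ext.hom (congr_fun h i)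
  · refine ⟨Ext.homEquiv.symm (Cofan.IsColimit.desc hf fun i => (ξ i).hom), funext fun i => ?_⟩
    ext
    rw [← Ext.singleFunctor_map_comp_hom]
    refine (congrArg _ (Ext.homEquiv.apply_symm_apply _)).trans ?_
    exact Cofan.IsColimit.fac hf _ i

lemma mono_sigmaMap_of_isEmpty [IsEmpty I] {X Y : I → A} (φ : ∀ i, X i ⟶ Y i) :
    Mono (Limits.Sigma.map φ) :=
  Preadditive.mono_of_cancel_zero _ fun {Z} a _ => by
    have : 𝟙 (∐ X) = 0 := Sigma.hom_ext _ _ fun i => isEmptyElim i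
    rw [← Category.comp_id a, this, comp_zero]

end

/-- for an AB3 abelian category `A`, the following are equivalent:
(i) `A` is AB4 (coproducts of short exact sequences are short exact);
(ii) for every nonempty set `I` and family `{A_i}`, the canonical functor
`A ⥤ D(A)` sends the coproduct `⨁ A_i` computed in `A` to a coproduct of the `A_i`
in the derived category `D(A)`;
(iii) the natural map `Ext¹_A(⨁ A_i, B) → ∏ Ext¹_A(A_i, B)` is an isomorphism for all
such families and all objects `B`. -/
theorem stmt18 {A : Type u} [Category.{v} A] [Abelian A] [HasCoproducts.{v} A]
    [HasDerivedCategory.{w} A] [CategoryTheory.HasExt.{w} A] :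
    ((∀ (I : Type v) (S : I → ShortComplex A), (∀ i, (S i).ShortExact) →
        (sigmaShortComplex S).ShortExact) ↔
      (∀ (I : Type v), Nonempty I → ∀ (f : I → A),
        Nonempty (IsColimit (Cofan.mk
          ((DerivedCategory.singleFunctor A 0).obj (∐ f))
          (fun i => (DerivedCategory.singleFunctor A 0).map (Sigma.ι f i)))))) ∧
    ((∀ (I : Type v) (S : I → ShortComplex A), (∀ i, (S i).ShortExact) →
        (sigmaShortComplex S).ShortExact) ↔
      (∀ (I : Type v), Nonempty I → ∀ (f : I → A) (B : A),
        Function.Bijective (fun (η : Ext (∐ f) B 1) (i : I) =>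
          (Ext.mk₀ (Sigma.ι f i)).comp η (zero_add 1)))) := by
  have h₁ (h : ∀ (I : Type v) (S : I → ShortComplex A), (∀ i, (S i).ShortExact) →
      (sigmaShortComplex S).ShortExact) (I : Type v) (f : I → A) :
      Nonempty (IsColimit (Cofan.mk ((DerivedCategory.singleFunctor A 0).obj (∐ f))
        (fun i => (DerivedCategory.singleFunctor A 0).map (Sigma.ι f i)))) := by
    have := preservesHomology_colim_discrete (h I)
    have : PreservesColimitsOfShape (Discrete I) (DerivedCategory.singleFunctor A 0) :=
      DerivedCategory.preservesColimitsOfShape_discrete_singleFunctor 0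
    exact ⟨isColimitOfHasCoproductOfPreservesColimit (DerivedCategory.singleFunctor A 0) f⟩
  have h₂ (h : ∀ (I : Type v), Nonempty I → ∀ (f : I → A) (B : A),
      Function.Bijective (fun (η : Ext (∐ f) B 1) (i : I) =>
        (Ext.mk₀ (Sigma.ι f i)).comp η (zero_add 1))) (I : Type v) (S : I → ShortComplex A)
      (hS : ∀ i, (S i).ShortExact) : (sigmaShortComplex S).ShortExact := by
    have : Mono (Limits.Sigma.map fun i => (S i).f) := by
      rcases isEmpty_or_nonempty I with hI | hI
      · exact mono_sigmaMap_of_isEmpty _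
      · exact mono_sigmaMap_of_surjective_ext S hS (h I hI _ _).2
    exact sigmaShortComplex_shortExact_of_mono S hS
  exact ⟨⟨fun h I _ f => h₁ h I f,
      fun h => h₂ fun I hI f B => bijective_ext_sigmaι_of_isColimit f B (h I hI f).some 1⟩,
    fun h I _ f B => bijective_ext_sigmaι_of_isColimit f B (h₁ h I f).some 1, h₂⟩
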